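/- arXiv:1710.02557 — 5 statements merged into one kernel-verified Lean document; each statement's English description precedes it below -/
import Mathlib

section
/- A ring R is a UNC ring if and only if J(R) is nil and the quotient ring R/J(R) is a UNC ring. -/
/-- An element is nil-clean if it is the sum of an idempotent and a nilpotent. -/
def IsNilClean {R : Type*} [Ring R] (a : R) : Prop :=
  ∃ e b : R, IsIdempotentElem e ∧ IsNilpotent b ∧ a = e + b

/-- A ring is a UNC ring if every unit is nil-clean. -/
def IsUNCRing (R : Type*) [Ring R] : Prop :=
  ∀ u : Rˣ, IsNilClean (u : R)

theorem IsNilClean.map {R S : Type*} [Ring R] [Ring S] (f : R →+* S) {a : R}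
    (ha : IsNilClean a) : IsNilClean (f a) := by
  obtain ⟨e, b, he, hb, rfl⟩ := ha
  exact ⟨f e, f b, he.map f, hb.map f, map_add f e b⟩

theorem TwoSidedIdeal.isUnit_one_add_of_mem_jacobson_bot {R : Type*} [Ring R] {x : R}
    (hx : x ∈ jacobson (⊥ : TwoSidedIdeal R)) : IsUnit (1 + x) := by
  have left_inv : ∀ y ∈ jacobson (⊥ : TwoSidedIdeal R), ∃ z, z * (1 + y) = 1 := by
    intro y hy
    obtain ⟨z, hz⟩ := mem_jacobson_iff.1 hy 1
    rw [mem_bot, mul_one, sub_eq_zero] at hz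
    exact ⟨z, by rw [mul_add, mul_one, add_comm, hz]⟩
  obtain ⟨z, hz⟩ := left_inv x hx
  obtain ⟨w, hw⟩ := left_inv (-(z * x)) (neg_mem _ (mul_mem_left _ _ _ hx))
  have hzx : 1 + -(z * x) = z := by
    rw [← hz, mul_add, mul_one, add_neg_cancel_right]
  rw [hzx] at hw
  have hwx : w = 1 + x := left_inv_eq_right_inv hw hz
  exact ⟨⟨1 + x, z, hwx ▸ hw, hz⟩, rfl⟩

theorem TwoSidedIdeal.isLocalHom_of_ker_le_jacobson_bot {R S : Type*} [Ring R] [Ring S]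
    (f : R →+* S) (hf : Function.Surjective f)
    (hker : ker f ≤ jacobson (⊥ : TwoSidedIdeal R)) : IsLocalHom f := by
  have isUnit_of_map_eq_one : ∀ c : R, f c = 1 → IsUnit c := by
    intro c hc
    have hmem : c - 1 ∈ ker f := by simp [mem_ker, hc]
    simpa using isUnit_one_add_of_mem_jacobson_bot (hker hmem)
  refine ⟨fun a ha ↦ ?_⟩
  obtain ⟨u, hu⟩ := ha
  obtain ⟨b, hb⟩ := hf ↑u⁻¹
  obtain ⟨p, hp⟩ := isUnit_of_map_eq_one (a * b) (by rw [map_mul, ← hu, hb, u.mul_inv])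
  obtain ⟨q, hq⟩ := isUnit_of_map_eq_one (b * a) (by rw [map_mul, ← hu, hb, u.inv_mul])
  have hr : a * (b * ↑p⁻¹) = 1 := by rw [← mul_assoc, ← hp, p.mul_inv]
  have hl : (↑q⁻¹ * b) * a = 1 := by rw [mul_assoc, ← hq, q.inv_mul]
  exact ⟨⟨a, b * ↑p⁻¹, hr, left_inv_eq_right_inv hl hr ▸ hl⟩, rfl⟩

theorem TwoSidedIdeal.eq_zero_of_isIdempotentElem_of_mem_jacobson_bot {R : Type*} [Ring R]
    {e : R} (he : IsIdempotentElem e) (hmem : e ∈ jacobson (⊥ : TwoSidedIdeal R)) : e = 0 := by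
  have hu := isUnit_one_add_of_mem_jacobson_bot (neg_mem _ hmem)
  rw [← hu.mul_right_eq_zero, ← sub_eq_add_neg, sub_mul, one_mul, he.eq, sub_self]

theorem IsUNCRing.isNilpotent_of_mem_jacobson_bot {R : Type*} [Ring R] (hR : IsUNCRing R)
    {x : R} (hx : x ∈ TwoSidedIdeal.jacobson (⊥ : TwoSidedIdeal R)) : IsNilpotent x := by
  obtain ⟨u, hu⟩ := TwoSidedIdeal.isUnit_one_add_of_mem_jacobson_bot hx
  obtain ⟨e, b, he, hb, h⟩ := hR u
  rw [hu] at h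
  have hb' : b = (1 - e) + x := by rw [sub_add_eq_add_sub, h, add_sub_cancel_left]
  set J := TwoSidedIdeal.jacobson (⊥ : TwoSidedIdeal R)
  have mem_of_map : ∀ y : R, J.ringCon.mk' y = 0 → y ∈ J := fun y hy ↦ by
    rwa [← TwoSidedIdeal.ker_ringCon_mk' J, TwoSidedIdeal.mem_ker]
  have hx0 : J.ringCon.mk' x = 0 := by
    rwa [← TwoSidedIdeal.mem_ker, TwoSidedIdeal.ker_ringCon_mk']
  have hnil : IsNilpotent (J.ringCon.mk' (1 - e)) := by
    have := hb.map J.ringCon.mk'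
    rwa [hb', map_add, hx0, add_zero] at this
  have hmem : 1 - e ∈ J := by
    obtain ⟨n, hn⟩ := hnil
    refine mem_of_map _ ?_
    rw [← (he.one_sub.map J.ringCon.mk').pow_succ_eq n, pow_succ, hn, zero_mul]
  rw [TwoSidedIdeal.eq_zero_of_isIdempotentElem_of_mem_jacobson_bot he.one_sub hmem,
    zero_add] at hb'
  exact hb' ▸ hb

theorem IsUNCRing.of_surjective {R S : Type*} [Ring R] [Ring S] (hR : IsUNCRing R)
    (f : R →+* S) [IsLocalHom f] (hf : Function.Surjective f) : IsUNCRing S := by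
  intro u
  obtain ⟨a, ha⟩ := hf u
  obtain ⟨v, rfl⟩ := isUnit_of_map_unit f a (ha ▸ u.isUnit)
  exact ha ▸ (hR v).map f

theorem IsNilClean.of_map {R S : Type*} [Ring R] [Ring S] (f : R →+* S)
    (hf : Function.Surjective f) (hker : ∀ x ∈ RingHom.ker f, IsNilpotent x) {a : R}
    (ha : IsNilClean (f a)) : IsNilClean a := by
  obtain ⟨e, b, he, ⟨n, hn⟩, h⟩ := ha
  obtain ⟨e', he', rfl⟩ := exists_isIdempotentElem_eq_of_ker_isNilpotent f hker e (hf e) he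
  refine ⟨e', a - e', he', ?_, (add_sub_cancel e' a).symm⟩
  refine IsNilpotent.of_pow (hker ((a - e') ^ n) ?_)
  rw [RingHom.mem_ker, map_pow, map_sub, h, add_sub_cancel_left, hn]

/-- `R` is a UNC ring iff `J(R)` is nil and `R/J(R)` is a UNC ring. -/
theorem stmt_1 (R : Type*) [Ring R] :
    IsUNCRing R ↔
      (∀ x ∈ TwoSidedIdeal.jacobson (⊥ : TwoSidedIdeal R), IsNilpotent x) ∧
        IsUNCRing (TwoSidedIdeal.jacobson (⊥ : TwoSidedIdeal R)).ringCon.Quotient := by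
  set J := TwoSidedIdeal.jacobson (⊥ : TwoSidedIdeal R)
  have hsurj : Function.Surjective J.ringCon.mk' := J.ringCon.mk'_surjective
  constructor
  · intro hR
    have := TwoSidedIdeal.isLocalHom_of_ker_le_jacobson_bot J.ringCon.mk' hsurj
      (TwoSidedIdeal.ker_ringCon_mk' J).le
    exact ⟨fun x hx ↦ hR.isNilpotent_of_mem_jacobson_bot hx, hR.of_surjective _ hsurj⟩
  · rintro ⟨hnil, hQ⟩ u
    refine .of_map J.ringCon.mk' hsurj (fun x hx ↦ hnil x ?_)
      (hQ (Units.map (J.ringCon.mk' : R →* J.ringCon.Quotient) u))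
    rwa [RingHom.mem_ker, ← TwoSidedIdeal.mem_ker, TwoSidedIdeal.ker_ringCon_mk'] at hx
end

section
/- If R is a UNC ring and G is a locally finite 2-group, then the group ring RG is a UNC ring. -/
namespace MonoidAlgebra

variable {R G H : Type*} [Ring R] [Group G] [Group H]

variable (R G) in
/-- The augmentation homomorphism of a group ring, with no commutativity assumption. -/
noncomputable def augmentationHom : MonoidAlgebra R G →+* R :=
  liftNCRingHom (RingHom.id R) 1 fun _ _ => Commute.one_right _

@[simp]
lemma augmentationHom_single (g : G) (r : R) :
    augmentationHom R G (single g r) = r := by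
  simp [augmentationHom]

@[simp]
lemma augmentationHom_mapDomain (f : G → H) (x : MonoidAlgebra R G) :
    augmentationHom R H (mapDomain f x) = augmentationHom R G x := by
  induction x using induction_linear with
  | zero => simp
  | add x y hx hy => simp [mapDomain_add, hx, hy]
  | single g r => simp

lemma eq_single_augmentationHom [Subsingleton G] (x : MonoidAlgebra R G) :
    x = single 1 (augmentationHom R G x) := by
  induction x using induction_linear with
  | zero => simp
  | add x y hx hy => rw [map_add, single_add, ← hx, ← hy]
  | single g r => simp [Subsingleton.elim g 1]

lemma one_sub_single_dvd_sub_mapDomain {z : G} (hz : z ∈ Subgroup.center G) (hz2 : z ^ 2 = 1)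
    (x : MonoidAlgebra R G) :
    1 - single z 1 ∣ x - mapDomain (fun g : G => (g : G ⧸ Subgroup.zpowers z).out) x := by
  induction x using induction_linear with
  | zero => simp
  | add x y hx hy =>
    rw [mapDomain_add, add_sub_add_comm]
    exact dvd_add hx hy
  | single g r =>
    obtain ⟨⟨h, hmem⟩, hh⟩ := QuotientGroup.mk_out_eq_mul (Subgroup.zpowers z) g
    obtain ⟨k, rfl⟩ := hmem
    rw [mapDomain_single, hh]
    rcases Int.even_or_odd' k with ⟨m, rfl | rfl⟩
    · simp [zpow_mul, show z ^ (2 : ℤ) = 1 from mod_cast hz2]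
    · refine ⟨single g r, ?_⟩
      simp [zpow_add, zpow_mul, show z ^ (2 : ℤ) = 1 from mod_cast hz2, sub_mul,
        Subgroup.mem_center_iff.mp hz g]

lemma isNilpotent_one_sub_single (h2 : IsNilpotent (2 : R)) {z : G} (hz2 : z ^ 2 = 1) :
    IsNilpotent (1 - single z 1 : MonoidAlgebra R G) := by
  have h2' : IsNilpotent (2 : MonoidAlgebra R G) := by
    have := h2.map (singleOneRingHom : R →+* MonoidAlgebra R G)
    rwa [map_ofNat] at this
  have hsq : (1 - single z 1 : MonoidAlgebra R G) ^ 2 = 2 * (1 - single z 1) := by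
    have hz : (single z 1 : MonoidAlgebra R G) * single z 1 = 1 := by
      rw [single_mul_single, ← sq, hz2, one_mul, one_def]
    rw [sq, mul_sub, mul_one, sub_mul, one_mul, hz, two_mul]
    abel
  refine IsNilpotent.of_pow (m := 2) ?_
  rw [hsq]
  exact (Commute.ofNat_left 2 _).isNilpotent_mul_right h2'

/-- Over a ring in which `2` is nilpotent, the augmentation ideal of a finite `2`-group is nil. -/
theorem isNilpotent_of_augmentationHom_eq_zero_of_finite (h2 : IsNilpotent (2 : R)) [Finite G]
    (hG : IsPGroup 2 G) {x : MonoidAlgebra R G} (hx : augmentationHom R G x = 0) :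
    IsNilpotent x := by
  induction hn : Nat.card G using Nat.strong_induction_on generalizing G with
  | _ n ih =>
  rcases subsingleton_or_nontrivial G with _ | _
  · rw [eq_single_augmentationHom x, hx, single_zero]
    exact IsNilpotent.zero
  have := hG.center_nontrivial
  obtain ⟨k, hk0, hk⟩ := (hG.to_subgroup (Subgroup.center G)).nontrivial_iff_card.mp this
  obtain ⟨⟨z, hz⟩, hord⟩ := exists_prime_orderOf_dvd_card' (G := Subgroup.center G) 2
    (hk ▸ dvd_pow_self 2 hk0.ne')
  rw [Subgroup.orderOf_mk] at hord
  have hz2 : z ^ 2 = 1 := hord ▸ pow_orderOf_eq_one z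
  have : (Subgroup.zpowers z).Normal :=
    ⟨fun h hh g => by
      have hc : h ∈ Subgroup.center G := (Subgroup.zpowers_le.mpr hz) hh
      rwa [Subgroup.mem_center_iff.mp hc g, mul_inv_cancel_right]⟩
  have hcard : Nat.card (G ⧸ Subgroup.zpowers z) < n := by
    have h1 := Subgroup.card_eq_card_quotient_mul_card_subgroup (Subgroup.zpowers z)
    have h0 : 0 < Nat.card (G ⧸ Subgroup.zpowers z) := Nat.card_pos
    rw [Nat.card_zpowers, hord, hn] at h1
    omega
  obtain ⟨m, hm⟩ := ih _ hcard (hG.to_quotient _)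
    (x := mapDomainRingHom R (QuotientGroup.mk' (Subgroup.zpowers z)) x) (by simpa using hx) rfl
  rw [← map_pow] at hm
  obtain ⟨y, hy⟩ := one_sub_single_dvd_sub_mapDomain hz hz2 (x ^ m)
  have hzero : mapDomain (fun g : G => (g : G ⧸ Subgroup.zpowers z).out) (x ^ m) = 0 := by
    have : mapDomain (Quotient.out : G ⧸ Subgroup.zpowers z → G)
        (mapDomain (QuotientGroup.mk' (Subgroup.zpowers z)) (x ^ m)) = 0 := by
      rw [show mapDomain (QuotientGroup.mk' (Subgroup.zpowers z)) (x ^ m) = 0 by simpa using hm,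
        mapDomain_zero]
    rw [← this]
    ext1
    exact Finsupp.mapDomain_comp
  rw [hzero, sub_zero] at hy
  refine IsNilpotent.of_pow (m := m) ?_
  rw [hy]
  refine Commute.isNilpotent_mul_right ?_ (isNilpotent_one_sub_single h2 hz2)
  exact (Commute.one_left y).sub_left
    (single_commute (fun g => (Subgroup.mem_center_iff.mp hz g).symm) Commute.one_left y)

/-- Over a ring in which `2` is nilpotent, the augmentation ideal of a locally finite `2`-group
is nil. -/
theorem isNilpotent_of_augmentationHom_eq_zero (h2 : IsNilpotent (2 : R))
    (hlf : ∀ S : Subgroup G, Group.FG S → Finite S) (hG : IsPGroup 2 G)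
    {x : MonoidAlgebra R G} (hx : augmentationHom R G x = 0) : IsNilpotent x := by
  let S := Subgroup.closure (x.coeff.support : Set G)
  have : Finite S := hlf S (Group.closure_finset_fg x.coeff.support)
  have hxS : mapDomain S.subtype (comapDomain S.subtype S.subtype_injective x) = x :=
    mapDomain_comapDomain (by simp [S]) _
  have hy := isNilpotent_of_augmentationHom_eq_zero_of_finite h2 (hG.to_subgroup S)
    (x := comapDomain S.subtype S.subtype_injective x)
    (by rw [← augmentationHom_mapDomain S.subtype, hxS, hx])
  rw [← hxS]
  exact hy.map (mapDomainRingHom R S.subtype)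

end MonoidAlgebra

theorem IsUNCRing.isNilpotent_two {R : Type*} [Ring R] (hR : IsUNCRing R) :
    IsNilpotent (2 : R) := by
  obtain ⟨e, b, he, hb, h⟩ := hR (-1)
  obtain rfl : b = -1 - e := by simpa [eq_sub_iff_add_eq'] using h.symm
  have hu : IsUnit e := by
    simpa using hb.isUnit_one_add.neg
  obtain rfl : e = 1 := hu.mul_left_cancel (by rw [he.eq, mul_one])
  simpa [← neg_add', one_add_one_eq_two] using hb

/-- If `R` is a UNC ring and `G` is a locally finite `2`-group, then the group
ring `RG` is a UNC ring. -/
theorem stmt_9 (R : Type*) [Ring R] (G : Type*) [Group G]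
    (hR : IsUNCRing R)
    (hlf : ∀ S : Subgroup G, Group.FG S → Finite S)
    (h2 : ∀ g : G, ∃ n : ℕ, orderOf g = 2 ^ n) :
    IsUNCRing (MonoidAlgebra R G) := by
  intro u
  obtain ⟨e, b, he, ⟨n, hn⟩, h⟩ := hR (Units.map (MonoidAlgebra.augmentationHom R G) u)
  refine ⟨MonoidAlgebra.single 1 e, (u : MonoidAlgebra R G) - MonoidAlgebra.single 1 e, ?_, ?_,
    (add_sub_cancel _ _).symm⟩
  · exact he.map (MonoidAlgebra.singleOneRingHom : R →+* MonoidAlgebra R G)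
  · refine IsNilpotent.of_pow (m := n) <|
      MonoidAlgebra.isNilpotent_of_augmentationHom_eq_zero hR.isNilpotent_two hlf
        (IsPGroup.iff_orderOf.mpr h2) ?_
    have h' : MonoidAlgebra.augmentationHom R G u = e + b := h
    rw [map_pow, map_sub, h', MonoidAlgebra.augmentationHom_single, add_sub_cancel_left, hn]
end

section
/- Let R be a nontrivial ring and G a group. If the group ring RG is a UU ring, then R is a UU ring and G is a 2-group. Conversely, if G is locally finite, R is a UU ring, and G is a 2-group, then RG is a UU ring. -/
/-- A ring is a UU ring if every unit is `1 +` a nilpotent. -/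
def IsUURing (R : Type*) [Ring R] : Prop :=
  ∀ u : Rˣ, ∃ b : R, IsNilpotent b ∧ (u : R) = 1 + b

/-- The augmentation map `∑ r_g g ↦ ∑ r_g`. -/
noncomputable def MonoidAlgebra.augmentation (R G : Type*) [Semiring R] [Monoid G] :
    MonoidAlgebra R G →+* R :=
  MonoidAlgebra.liftNCRingHom (RingHom.id R) (1 : G →* R) fun _ _ => Commute.one_right _

namespace MonoidAlgebra

section Semiring

variable {R G H : Type*} [Semiring R]

@[simp]
theorem augmentation_single [Monoid G] (g : G) (r : R) :
    augmentation R G (single g r) = r := by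
  simp [augmentation]

theorem augmentation_mapDomain [Monoid G] [Monoid H] (f : G → H) (x : MonoidAlgebra R G) :
    augmentation R H (mapDomain f x) = augmentation R G x := by
  induction x using induction_linear with
  | zero => simp
  | add x y hx hy => rw [mapDomain_add, map_add, map_add, hx, hy]
  | single g r => simp

theorem eq_single_augmentation [Monoid G] [Subsingleton G] (x : MonoidAlgebra R G) :
    x = single 1 (augmentation R G x) := by
  induction x using induction_linear with
  | zero => simp
  | add x y hx hy => rw [map_add, single_add, ← hx, ← hy]
  | single g r => rw [augmentation_single, Subsingleton.elim g 1]

end Semiring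

end MonoidAlgebra

theorem IsUURing.isNilpotent_sub_one {S : Type*} [Ring S] (h : IsUURing S) {u : S}
    (hu : IsUnit u) : IsNilpotent (u - 1) := by
  obtain ⟨b, hb, hub⟩ := h hu.unit
  rw [IsUnit.unit_spec] at hub
  rwa [hub, add_sub_cancel_left]

theorem IsUURing.isNilpotent_two {S : Type*} [Ring S] (h : IsUURing S) :
    IsNilpotent (2 : S) := by
  have := (h.isNilpotent_sub_one (u := -1) isUnit_one.neg).neg
  norm_num at this
  exact this

theorem exists_sub_one_pow_two_pow_eq {S : Type*} [Ring S] (a : S) (n : ℕ) :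
    ∃ y : S, (a - 1) ^ 2 ^ n = a ^ 2 ^ n - 1 + 2 * y := by
  induction n with
  | zero => exact ⟨0, by simp⟩
  | succ n ih =>
    obtain ⟨y, hy⟩ := ih
    set b := a ^ 2 ^ n with hb
    refine ⟨1 - b + (b - 1) * y + y * (b - 1) + 2 * y * y, ?_⟩
    rw [pow_succ, pow_mul, pow_mul, ← hb, hy]
    noncomm_ring

namespace MonoidAlgebra

variable {R G : Type*} [Ring R] [Group G]

theorem isUURing_of_isUURing (h : IsUURing (MonoidAlgebra R G)) : IsUURing R := by
  intro u
  refine ⟨u - 1, ?_, by simp⟩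
  have := (h.isNilpotent_sub_one (u.isUnit.map (singleOneRingHom (R := R) (M := G)))).map
    (augmentation R G)
  simpa using this

theorem exists_orderOf_eq_two_pow_of_isUURing [Nontrivial R]
    (h : IsUURing (MonoidAlgebra R G)) (g : G) : ∃ n : ℕ, orderOf g = 2 ^ n := by
  obtain ⟨n, hn⟩ := h.isNilpotent_sub_one ((Group.isUnit g).map (of R G))
  obtain ⟨y, hy⟩ := exists_sub_one_pow_two_pow_eq (of R G g) n
  rw [pow_eq_zero_of_le n.lt_two_pow_self.le hn, ← map_pow] at hy
  suffices g ^ 2 ^ n = 1 by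
    obtain ⟨k, -, hk⟩ := (Nat.dvd_prime_pow Nat.prime_two).1 (orderOf_dvd_of_pow_eq_one this)
    exact ⟨k, hk⟩
  by_contra hg
  have h1 : (0 : R) = -1 + 2 * y.coeff 1 := by
    have := congrArg (fun x => x.coeff 1) hy
    simpa [two_mul, one_def, hg, Finsupp.single_apply] using this
  have h2 : (2 : R) * y.coeff 1 = 1 := by
    rw [← sub_eq_zero, h1]; abel
  have h3 : IsNilpotent ((2 : R) * y.coeff 1) :=
    (Commute.ofNat_left 2 _).isNilpotent_mul_right (isUURing_of_isUURing h).isNilpotent_two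
  rw [h2] at h3
  exact not_isNilpotent_one h3

theorem isNilpotent_of_sub_one (h2 : IsNilpotent (2 : R)) {z : G} {n : ℕ} (hz : z ^ 2 ^ n = 1) :
    IsNilpotent (of R G z - 1) := by
  obtain ⟨y, hy⟩ := exists_sub_one_pow_two_pow_eq (of R G z) n
  rw [← map_pow, hz, map_one, sub_self, zero_add] at hy
  have h2' : IsNilpotent (2 : MonoidAlgebra R G) := by
    simpa only [map_ofNat] using h2.map (singleOneRingHom (R := R) (M := G))
  have := (Commute.ofNat_left 2 y).isNilpotent_mul_right h2'
  rw [← hy] at this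
  exact this.of_pow

theorem commute_of_of_mem_center {z : G} (hz : z ∈ Subgroup.center G) (x : MonoidAlgebra R G) :
    Commute (of R G z) x := by
  induction x using induction_linear with
  | zero => exact Commute.zero_right _
  | add x y hx hy => exact hx.add_right hy
  | single g r =>
    simp [commute_iff_eq, single_mul_single, Subgroup.mem_center_iff.1 hz g]

theorem exists_eq_sub_one_mul_add_mapDomain [Finite G] {z : G} (hz : z ∈ Subgroup.center G)
    (x : MonoidAlgebra R G) :
    ∃ w, x = (of R G z - 1) * w +
      mapDomain Quotient.out (mapDomain (QuotientGroup.mk (s := Subgroup.zpowers z)) x) := by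
  induction x using induction_linear with
  | zero => exact ⟨0, by simp⟩
  | add x y hx hy =>
    obtain ⟨v, hv⟩ := hx
    obtain ⟨w, hw⟩ := hy
    refine ⟨v + w, ?_⟩
    rw [mapDomain_add, mapDomain_add, mul_add, add_add_add_comm, ← hv, ← hw]
  | single g r =>
    rw [mapDomain_single, mapDomain_single]
    set s : G := Quotient.out (QuotientGroup.mk (s := Subgroup.zpowers z) g) with hs
    have hmem : s⁻¹ * g ∈ Subgroup.zpowers z :=
      QuotientGroup.eq.1 (by rw [hs]; exact QuotientGroup.out_eq' _)
    obtain ⟨k, hk⟩ := mem_powers_iff_mem_zpowers.2 hmem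
    obtain ⟨c, hc⟩ := sub_one_dvd_pow_sub_one (of R G z) k
    refine ⟨c * single s r, ?_⟩
    have hg : g = z ^ k * s := by
      rw [← Subgroup.mem_center_iff.1 (pow_mem hz k) s]
      simp_all
    rw [← mul_assoc, ← hc, sub_mul, one_mul, sub_add_cancel, ← map_pow, of_apply,
      single_mul_single, one_mul, ← hg]

theorem isNilpotent_of_augmentation_eq_zero_of_finite [Finite G] (hG : IsPGroup 2 G)
    (h2 : IsNilpotent (2 : R)) {x : MonoidAlgebra R G} (hx : augmentation R G x = 0) :
    IsNilpotent x := by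
  induction hn : Nat.card G using Nat.strong_induction_on generalizing G with
  | _ n ih =>
    subst hn
    cases subsingleton_or_nontrivial G with
    | inl _ =>
      rw [eq_single_augmentation x, hx, single_zero]
      exact IsNilpotent.zero
    | inr _ =>
      have := hG.center_nontrivial
      obtain ⟨⟨z, hz⟩, hz1⟩ := exists_ne (1 : Subgroup.center G)
      replace hz1 : z ≠ 1 := fun h => hz1 (Subtype.ext h)
      have : (Subgroup.zpowers z).Normal :=
        ⟨fun a ha g => by
          rwa [Subgroup.mem_center_iff.1 (Subgroup.zpowers_le.2 hz ha) g, mul_inv_cancel_right]⟩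
      let π := mapDomainRingHom R (QuotientGroup.mk' (Subgroup.zpowers z))
      have hlt : Nat.card (G ⧸ Subgroup.zpowers z) < Nat.card G := by
        rw [Subgroup.card_eq_card_quotient_mul_card_subgroup (Subgroup.zpowers z)]
        refine lt_mul_of_one_lt_right Nat.card_pos ?_
        rw [Subgroup.one_lt_card_iff_ne_bot, Ne, Subgroup.zpowers_eq_bot]
        exact hz1
      obtain ⟨m, hm⟩ := ih _ hlt (hG.to_quotient _) (x := π x)
        ((augmentation_mapDomain _ x).trans hx) rfl
      rw [← map_pow] at hm
      obtain ⟨w, hw⟩ := exists_eq_sub_one_mul_add_mapDomain hz (x ^ m)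
      replace hm : mapDomain (QuotientGroup.mk (s := Subgroup.zpowers z)) (x ^ m) = 0 := hm
      rw [hm, mapDomain_zero, add_zero] at hw
      obtain ⟨k, hk⟩ := hG z
      have : IsNilpotent (x ^ m) := by
        rw [hw]
        exact ((commute_of_of_mem_center hz w).sub_left (Commute.one_left w)).isNilpotent_mul_right
          (isNilpotent_of_sub_one h2 hk)
      exact this.of_pow

theorem isNilpotent_of_augmentation_eq_zero
    (hfin : ∀ S : Subgroup G, Group.FG S → Finite S) (hG : IsPGroup 2 G)
    (h2 : IsNilpotent (2 : R)) {x : MonoidAlgebra R G} (hx : augmentation R G x = 0) :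
    IsNilpotent x := by
  let S := Subgroup.closure (x.coeff.support : Set G)
  have : Finite S := hfin S (Group.closure_finset_fg _)
  have hsupp : (x.coeff.support : Set G) ⊆ Set.range S.subtype := by
    rw [Subgroup.coe_subtype, Subtype.range_coe]
    exact Subgroup.subset_closure
  have hxS := mapDomain_comapDomain hsupp S.subtype_injective
  rw [← hxS, augmentation_mapDomain] at hx
  have := (isNilpotent_of_augmentation_eq_zero_of_finite (hG.to_subgroup S) h2 hx).map
    (mapDomainRingHom R S.subtype)
  rw [← hxS]
  exact this

theorem isUURing (hfin : ∀ S : Subgroup G, Group.FG S → Finite S) (hG : IsPGroup 2 G)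
    (hR : IsUURing R) : IsUURing (MonoidAlgebra R G) := by
  intro u
  refine ⟨u - 1, ?_, by simp⟩
  obtain ⟨n, hn⟩ := hR.isNilpotent_sub_one (u.isUnit.map (augmentation R G))
  have : IsNilpotent (((u : MonoidAlgebra R G) - 1) ^ n) :=
    isNilpotent_of_augmentation_eq_zero hfin hG hR.isNilpotent_two (by simpa using hn)
  exact this.of_pow

end MonoidAlgebra

/-- If the group ring `RG` is a UU ring, then `R` is a UU ring and `G` is a
`2`-group; the converse holds when `G` is locally finite. -/
theorem stmt_11 (R : Type*) [Ring R] [Nontrivial R] (G : Type*) [Group G] :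
    (IsUURing (MonoidAlgebra R G) →
      IsUURing R ∧ ∀ g : G, ∃ n : ℕ, orderOf g = 2 ^ n) ∧
    ((∀ S : Subgroup G, Group.FG S → Finite S) →
      IsUURing R → (∀ g : G, ∃ n : ℕ, orderOf g = 2 ^ n) →
        IsUURing (MonoidAlgebra R G)) := by
  exact ⟨fun h => ⟨MonoidAlgebra.isUURing_of_isUURing h,
      MonoidAlgebra.exists_orderOf_eq_two_pow_of_isUURing h⟩,
    fun hfin hR hG => MonoidAlgebra.isUURing hfin (IsPGroup.iff_orderOf.2 hG) hR⟩
end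

section
/- A ring R is strongly nil-clean if and only if R is a semipotent UU ring. -/
/-- An element is strongly nil-clean if it is the sum of an idempotent and a
nilpotent that commute. -/
def IsStronglyNilClean {R : Type*} [Ring R] (a : R) : Prop :=
  ∃ e b : R, IsIdempotentElem e ∧ IsNilpotent b ∧ Commute e b ∧ a = e + b

/-- A ring is semipotent if for every `a ∉ J(R)` there is `x` with `ax` a
nonzero idempotent. -/
def IsSemipotentRing (R : Type*) [Ring R] : Prop :=
  ∀ a : R, a ∉ Ideal.jacobson (⊥ : Ideal R) →
    ∃ x : R, IsIdempotentElem (a * x) ∧ a * x ≠ 0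

section StronglyNilClean

variable {R : Type*} [Ring R]

open Polynomial in
/-- An element `a` with `a - a ^ 2` nilpotent is strongly nil-clean. -/
theorem isStronglyNilClean_of_isNilpotent_sub_sq {a : R} (h : IsNilpotent (a - a ^ 2)) :
    IsStronglyNilClean a := by
  obtain ⟨n, hn⟩ := h
  rcases n with - | n
  · have := subsingleton_of_zero_eq_one (by simpa using hn.symm)
    exact ⟨0, 0, .zero, .zero, .zero_left _, Subsingleton.elim _ _⟩
  have hdvd : (X - X ^ 2 : ℤ[X]) ∣ X - (1 - (1 - X ^ (n + 1)) ^ (n + 1)) := by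
    have hX : (X : ℤ[X]) ∣ X - (1 - (1 - X ^ (n + 1)) ^ (n + 1)) := by
      rw [X_dvd_iff, coeff_zero_eq_eval_zero]
      simp
    have hX' : (1 - X : ℤ[X]) ∣ X - (1 - (1 - X ^ (n + 1)) ^ (n + 1)) := by
      rw [← neg_sub, neg_dvd, ← C_1, dvd_iff_isRoot]
      simp
    have hcop : IsCoprime (X : ℤ[X]) (1 - X) := ⟨1, 1, by ring⟩
    convert hcop.mul_dvd hX hX' using 1
    ring
  obtain ⟨q, hq⟩ := hdvd
  have hq := congrArg (aeval a) hq
  simp only [map_sub, map_mul, map_pow, map_one, aeval_X] at hq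
  have hcomm : Commute a (aeval a q) := by
    simpa using (Commute.all (X : ℤ[X]) q).map (aeval a)
  refine ⟨_, _, isIdempotentElem_one_sub_one_sub_pow_pow a (n + 1) hn, ?_, ?_,
    (add_sub_cancel _ a).symm⟩
  · rw [hq]
    exact (hcomm.sub_left (hcomm.pow_left 2)).isNilpotent_mul_right ⟨_, hn⟩
  · have hself : Commute (1 - (1 - a ^ (n + 1)) ^ (n + 1)) a :=
      (Commute.one_left a).sub_left
        (((Commute.one_left a).sub_left ((Commute.refl a).pow_left _)).pow_left _)
    exact hself.sub_right (.refl _)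

theorem isNilpotent_mul_swap {x y : R} (h : IsNilpotent (x * y)) : IsNilpotent (y * x) := by
  obtain ⟨n, hn⟩ := h
  refine ⟨n + 1, ?_⟩
  have hconj : SemiconjBy x (y * x) (x * y) := (mul_assoc x y x).symm
  rw [pow_succ', mul_assoc, (hconj.pow_right n).eq, hn, zero_mul, mul_zero]

/-- A ring all of whose elements are strongly nil-clean is a UU ring. -/
theorem isUURing_of_isStronglyNilClean (h : ∀ a : R, IsStronglyNilClean a) : IsUURing R := by
  intro u
  obtain ⟨e, b, he, hb, hcomm, hu⟩ := h u
  have hbu : Commute (-b) (u : R) := by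
    rw [hu]
    exact (hcomm.symm.add_right (.refl b)).neg_left
  have heunit : IsUnit e := by
    have := hb.neg.isUnit_add_left_of_commute u.isUnit hbu
    rwa [hu, add_neg_cancel_right] at this
  exact ⟨b, hb, by rw [hu, (IsIdempotentElem.iff_eq_one_of_isUnit heunit).mp he]⟩

/-- A ring all of whose elements are strongly nil-clean is semipotent. -/
theorem isSemipotentRing_of_isStronglyNilClean (h : ∀ a : R, IsStronglyNilClean a) :
    IsSemipotentRing R := by
  intro a ha
  obtain ⟨y, hy⟩ : ∃ y, ¬ IsNilpotent (y * a) := by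
    contrapose! ha
    rw [Ideal.mem_jacobson_iff]
    intro y
    obtain ⟨u, hu⟩ := (ha y).isUnit_add_one
    refine ⟨↑u⁻¹, ?_⟩
    rw [Ideal.mem_bot, mul_assoc, ← mul_add_one, ← hu, Units.inv_mul, sub_self]
  obtain ⟨e, b, he, hb, hcomm, hab⟩ := h (a * y)
  obtain ⟨u, hu⟩ := hb.isUnit_one_add
  have hmul : a * (y * e * ↑u⁻¹) = e := by
    rw [← mul_assoc, ← mul_assoc, hab, Units.mul_inv_eq_iff_eq_mul, hu, add_mul, he.eq,
      ← hcomm.eq, mul_add, mul_one]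
  refine ⟨y * e * ↑u⁻¹, by rwa [hmul], ?_⟩
  rw [hmul]
  rintro rfl
  rw [zero_add] at hab
  exact hy (isNilpotent_mul_swap (hab ▸ hb))

theorem isUnit_one_add_of_mem_jacobson_bot {j : R} (hj : j ∈ Ideal.jacobson (⊥ : Ideal R)) :
    IsUnit (1 + j) := by
  obtain ⟨z, hz⟩ := Ideal.exists_mul_add_sub_mem_of_mem_jacobson j hj
  rw [Ideal.mem_bot, sub_eq_zero] at hz
  have hz1 : z - 1 ∈ Ideal.jacobson (⊥ : Ideal R) := by
    have : z - 1 = -(z * j) := by rw [← hz]; noncomm_ring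
    rw [this]
    exact neg_mem (Ideal.mul_mem_left _ z hj)
  obtain ⟨w, hw⟩ := Ideal.exists_mul_sub_mem_of_sub_one_mem_jacobson z hz1
  rw [Ideal.mem_bot, sub_eq_zero] at hw
  have hwj : w = j + 1 := left_inv_eq_right_inv hw hz
  rw [add_comm]
  exact ⟨⟨j + 1, z, hwj ▸ hw, hz⟩, rfl⟩

/-- The Jacobson radical of a UU ring is nil. -/
theorem IsUURing.isNilpotent_of_mem_jacobson_bot (h : IsUURing R) {j : R}
    (hj : j ∈ Ideal.jacobson (⊥ : Ideal R)) : IsNilpotent j := by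
  obtain ⟨u, hu⟩ := isUnit_one_add_of_mem_jacobson_bot hj
  obtain ⟨b, hb, hub⟩ := h u
  rwa [add_left_cancel (hu.symm.trans hub)]

/-- The quotient of a UU ring by its Jacobson radical is a UU ring. -/
theorem IsUURing.quotient_jacobson_bot (h : IsUURing R) :
    IsUURing (R ⧸ Ideal.jacobson (⊥ : Ideal R)) := by
  intro u
  obtain ⟨x, hx⟩ := Ideal.Quotient.mk_surjective (u : R ⧸ Ideal.jacobson (⊥ : Ideal R))
  obtain ⟨y, hy⟩ := Ideal.Quotient.mk_surjective (↑u⁻¹ : R ⧸ Ideal.jacobson (⊥ : Ideal R))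
  have key : ∀ {s t : R}, Ideal.Quotient.mk (Ideal.jacobson (⊥ : Ideal R)) (s * t) = 1 →
      IsUnit (s * t) := by
    intro s t hst
    rw [← map_one (Ideal.Quotient.mk _), Ideal.Quotient.mk_eq_mk_iff_sub_mem] at hst
    simpa using isUnit_one_add_of_mem_jacobson_bot hst
  obtain ⟨v, hv⟩ := key (s := x) (t := y) (by rw [map_mul, hx, hy, Units.mul_inv])
  obtain ⟨w, hw⟩ := key (s := y) (t := x) (by rw [map_mul, hx, hy, Units.inv_mul])
  have hr : x * (y * ↑v⁻¹) = 1 := by rw [← mul_assoc, ← hv, Units.mul_inv]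
  have hl : ↑w⁻¹ * y * x = 1 := by rw [mul_assoc, ← hw, Units.inv_mul]
  obtain ⟨b, hb, hxb⟩ := h ⟨x, y * ↑v⁻¹, hr, left_inv_eq_right_inv hl hr ▸ hl⟩
  refine ⟨Ideal.Quotient.mk _ b, hb.map _, ?_⟩
  rw [← hx, show x = 1 + b from hxb, map_add, map_one]

/-- A UU ring contains no nonzero full set of `2 × 2` matrix units: if `p` and `q` are the
off-diagonal ones, then `p = 0`. -/
theorem IsUURing.eq_zero_of_matrix_units (h : IsUURing R) {p q : R} (hpqp : p * (q * p) = p)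
    (hqpq : q * (p * q) = q) (hp : p * p = 0) (hq : q * q = 0) : p = 0 := by
  have hp' (x : R) : p * (p * x) = 0 := by rw [← mul_assoc, hp, zero_mul]
  have hq' (x : R) : q * (q * x) = 0 := by rw [← mul_assoc, hq, zero_mul]
  have hpqp' (x : R) : p * (q * (p * x)) = p * x := by
    rw [← mul_assoc q, ← mul_assoc, hpqp]
  have hqpq' (x : R) : q * (p * (q * x)) = q * x := by
    rw [← mul_assoc p, ← mul_assoc, hqpq]
  let u : Rˣ :=
    { val := 1 + (p + q - q * p)
      inv := 1 + (p + q - p * q - q * p - q * p)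
      val_inv := by
        simp only [mul_add, add_mul, mul_sub, sub_mul, mul_assoc, one_mul, mul_one, hp, hq, hp',
          hq', hpqp, hqpq, mul_zero]
        abel
      inv_val := by
        simp only [mul_add, add_mul, mul_sub, sub_mul, mul_assoc, one_mul, mul_one, hp, hq,
          hq', hpqp, hqpq, mul_zero]
        abel }
  obtain ⟨b, hb, hub⟩ := h u
  obtain rfl : p + q - q * p = b := add_left_cancel hub
  have hl : (p + q + p * q) * (p + q - q * p) = p * q + q * p := by
    simp only [mul_add, add_mul, mul_sub, mul_assoc, hp, hq, hq', hpqp]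
    abel
  have hr : (p + q - q * p) * (p + q + p * q) = p * q + q * p := by
    simp only [mul_add, add_mul, sub_mul, mul_assoc, hp, hq, hp', hqpq, mul_zero]
    abel
  have hnil : IsNilpotent (p * q + q * p) :=
    hl ▸ Commute.isNilpotent_mul_left (hl.trans hr.symm) hb
  have hidem : IsIdempotentElem (p * q + q * p) := by
    simp only [IsIdempotentElem, mul_add, add_mul, mul_assoc, hp', hq', hpqp', hqpq', mul_zero]
    abel
  have hzero := hidem.eq_zero_of_isNilpotent hnil
  calc p = (p * q + q * p) * p := by simp only [add_mul, mul_assoc, hp, hpqp, mul_zero, add_zero]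
    _ = 0 := by rw [hzero, zero_mul]

/-- A UU ring in which every nonzero right ideal contains a nonzero idempotent is reduced. -/
theorem IsUURing.isReduced (h : IsUURing R)
    (hR : ∀ a : R, a ≠ 0 → ∃ x, IsIdempotentElem (a * x) ∧ a * x ≠ 0) : IsReduced R := by
  rw [isReduced_iff_pow_one_lt 2 one_lt_two]
  intro a ha
  rw [pow_two] at ha
  by_contra hne
  obtain ⟨x, hx, hx0⟩ := hR a hne
  have ha' (y : R) : a * (a * y) = 0 := by rw [← mul_assoc, ha, zero_mul]
  have hx1 : a * (x * (a * x)) = a * x := by simpa only [IsIdempotentElem, mul_assoc] using hx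
  have hx2 (y : R) : a * (x * (a * (x * y))) = a * (x * y) := by
    simpa only [mul_assoc] using congrArg (· * y) hx1
  have hp : a * x * a = 0 := by
    apply h.eq_zero_of_matrix_units (q := (1 - a * x) * (x * (a * x))) <;>
    simp only [sub_mul, mul_sub, one_mul, mul_assoc, ha', hx1, hx2, mul_zero, sub_zero,
      sub_self]
  exact hx0 (by rw [← hx.eq, ← mul_assoc, hp, zero_mul])

/-- Idempotents of a reduced ring are central. -/
theorem IsIdempotentElem.commute_of_isReduced [IsReduced R] {e : R} (he : IsIdempotentElem e)
    (x : R) : Commute e x := by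
  have hee (y : R) : e * (e * y) = e * y := by rw [← mul_assoc, he.eq]
  have h1 : e * x - e * x * e = 0 := by
    refine IsReduced.eq_zero _ ⟨2, ?_⟩
    simp only [pow_two, mul_sub, sub_mul, mul_assoc, hee]
    abel
  have h2 : x * e - e * x * e = 0 := by
    refine IsReduced.eq_zero _ ⟨2, ?_⟩
    simp only [pow_two, mul_sub, sub_mul, mul_assoc, hee]
    abel
  exact (sub_eq_zero.mp h1).trans (sub_eq_zero.mp h2).symm

/-- A UU ring in which every nonzero right ideal contains a nonzero idempotent is Boolean. -/
theorem IsUURing.sub_sq_eq_zero (h : IsUURing R)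
    (hR : ∀ a : R, a ≠ 0 → ∃ x, IsIdempotentElem (a * x) ∧ a * x ≠ 0) (a : R) :
    a - a ^ 2 = 0 := by
  have hred := h.isReduced hR
  by_contra hne
  obtain ⟨x, he, he0⟩ := hR _ hne
  obtain ⟨e, hex⟩ : ∃ e, e = (a - a ^ 2) * x := ⟨_, rfl⟩
  rw [← hex] at he he0
  have hc (y : R) : e * y = y * e := he.commute_of_isReduced y
  obtain ⟨t, ht⟩ : ∃ t, t = e * (1 - a) * x := ⟨_, rfl⟩
  have het : e * t = t := by rw [ht, ← mul_assoc, ← mul_assoc, he.eq]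
  have hat : a * t = e := by
    calc a * t = e * ((a - a ^ 2) * x) := by
          rw [ht, ← mul_assoc, ← mul_assoc, ← hc a]; noncomm_ring
      _ = e := by rw [← hex, he.eq]
  have hidem : IsIdempotentElem (t * a) := by
    rw [IsIdempotentElem, mul_assoc, ← mul_assoc a, hat, ← mul_assoc, ← hc, het]
  have hta : t * a = e := by
    calc t * a = e * (t * a) := by rw [← mul_assoc, het]
      _ = (t * a) * (a * t) := by rw [hc, hat]
      _ = a * (t * a) * t := by rw [← mul_assoc, (hidem.commute_of_isReduced a).eq]
      _ = e := by rw [← mul_assoc, hat, mul_assoc, hat, he.eq]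
  have hte : t * e = t := by rw [← hc, het]
  let u : Rˣ :=
    { val := e * a + (1 - e)
      inv := t + (1 - e)
      val_inv := by
        simp only [add_mul, mul_add, mul_sub, sub_mul, mul_one, one_mul, mul_assoc, hat, het,
          he.eq, ← hc a]
        rw [← mul_assoc, he.eq]
        abel
      inv_val := by
        simp only [add_mul, mul_add, mul_sub, sub_mul, mul_one, one_mul, hte, he.eq,
          ← mul_assoc, hta]
        abel }
  obtain ⟨b, hb, hub⟩ := h u
  have hea : e * a = e := by
    have hub : e * a + (1 - e) = 1 + b := hub
    rw [hb.eq_zero, add_zero] at hub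
    rwa [add_sub_left_comm, add_eq_left, sub_eq_zero] at hub
  apply he0
  calc e = e * ((a - a ^ 2) * x) := by rw [← hex, he.eq]
    _ = (e * a - e * a * a) * x := by noncomm_ring
    _ = 0 := by rw [hea, hea, sub_self, zero_mul]

/-- In a semipotent UU ring every `a - a ^ 2` lies in the Jacobson radical. -/
theorem IsSemipotentRing.sub_sq_mem_jacobson_bot (hs : IsSemipotentRing R) (hu : IsUURing R)
    (a : R) : a - a ^ 2 ∈ Ideal.jacobson (⊥ : Ideal R) := by
  rw [← Ideal.Quotient.eq_zero_iff_mem, map_sub, map_pow]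
  refine hu.quotient_jacobson_bot.sub_sq_eq_zero (fun c hc ↦ ?_) _
  obtain ⟨c, rfl⟩ := Ideal.Quotient.mk_surjective c
  obtain ⟨x, hx, hx0⟩ := hs c (fun hmem ↦ hc (Ideal.Quotient.eq_zero_iff_mem.mpr hmem))
  refine ⟨Ideal.Quotient.mk _ x, ?_, ?_⟩
  · rw [← map_mul]
    exact hx.map _
  · rw [← map_mul, Ne, Ideal.Quotient.eq_zero_iff_mem]
    exact fun hmem ↦ hx0 (hx.eq_zero_of_isNilpotent (hu.isNilpotent_of_mem_jacobson_bot hmem))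

end StronglyNilClean

/-- `R` is strongly nil-clean iff `R` is a semipotent UU ring. -/
theorem stmt_13 (R : Type*) [Ring R] :
    (∀ a : R, IsStronglyNilClean a) ↔ IsSemipotentRing R ∧ IsUURing R := by
  refine ⟨fun h ↦ ⟨isSemipotentRing_of_isStronglyNilClean h, isUURing_of_isStronglyNilClean h⟩,
    fun ⟨hs, hu⟩ a ↦ ?_⟩
  exact isStronglyNilClean_of_isNilpotent_sub_sq
    (hu.isNilpotent_of_mem_jacobson_bot (hs.sub_sq_mem_jacobson_bot hu a))
end

section
/- A ring R is a strong UNII-ring if and only if 1 − u² is nilpotent for every unit u of R and 6 is nilpotent in R. -/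
/-- A ring is a strong UNII-ring if every unit is the sum of a nilpotent and two
idempotents that commute with one another. -/
def IsStrongUNIIRing (R : Type*) [Ring R] : Prop :=
  ∀ u : Rˣ, ∃ b e f : R, IsNilpotent b ∧ IsIdempotentElem e ∧ IsIdempotentElem f ∧
    Commute b e ∧ Commute b f ∧ Commute e f ∧ (u : R) = b + e + f

open Polynomial in
/-- In a commutative ring, an element that is idempotent modulo the nilradical is congruent to
an idempotent modulo the nilradical. -/
theorem exists_isIdempotentElem_isNilpotent_sub {S : Type*} [CommRing S] {a : S}
    (ha : IsNilpotent (a ^ 2 - a)) : ∃ e : S, IsIdempotentElem e ∧ IsNilpotent (a - e) := by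
  have hunit : IsUnit (2 * a - 1) := by
    have h : IsUnit (1 + 4 * (a ^ 2 - a)) :=
      ((Commute.all _ _).isNilpotent_mul_left ha).isUnit_one_add
    rw [show 1 + 4 * (a ^ 2 - a) = (2 * a - 1) * (2 * a - 1) by ring] at h
    exact isUnit_of_mul_isUnit_left h
  obtain ⟨e, ⟨hae, he⟩, -⟩ :=
    existsUnique_nilpotent_sub_and_aeval_eq_zero (R := ℤ) (P := X ^ 2 - X) (x := a)
      (by simpa using ha) (by simpa [map_ofNat] using hunit)
  refine ⟨e, ?_, hae⟩
  rw [IsIdempotentElem, ← pow_two]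
  simpa [sub_eq_zero] using he

theorem isNilpotent_mul_of_eq_add_idempotents {S : Type*} [CommRing S] {b e f : S}
    (hb : IsNilpotent b) (he : IsIdempotentElem e) (hf : IsIdempotentElem f) :
    IsNilpotent ((b + e + f) * (b + e + f - 1) * (b + e + f - 2)) := by
  have hg : (e + f) * (e + f - 1) * (e + f - 2) = 0 := by
    linear_combination (e - 2 + 3 * f) * he.eq + (f - 2 + 3 * e) * hf.eq
  have h : (b + e + f) * (b + e + f - 1) * (b + e + f - 2) =
      b * (b ^ 2 + 3 * b * (e + f) + 3 * (e + f) ^ 2 - 3 * b - 6 * (e + f) + 2) := by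
    linear_combination hg
  rw [h]
  exact (Commute.all _ _).isNilpotent_mul_right hb

theorem isNilpotent_mul_one_sub_sq {S : Type*} [CommRing S] {x : S}
    (h6 : IsNilpotent (6 : S)) (hx : IsNilpotent (x * (x - 1) * (x - 2))) :
    IsNilpotent (x * (1 - x ^ 2)) := by
  have h3 : 3 * x * (x - 1) ∈ nilradical S := by
    refine (mem_nilradical.2 (IsNilpotent.of_pow (m := 2) ?_))
    rw [show (3 * x * (x - 1)) ^ 2 =
      9 * (x + 1) * (x * (x - 1) * (x - 2)) + 3 * x * (x - 1) * 6 by ring]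
    exact add_mem (Ideal.mul_mem_left (nilradical S) _ hx)
      (Ideal.mul_mem_left (nilradical S) _ h6)
  rw [show x * (1 - x ^ 2) = -(x * (x - 1) * (x - 2) + 3 * x * (x - 1)) by ring]
  exact neg_mem (add_mem (S := Ideal S) (s := nilradical S) hx h3)

theorem exists_isIdempotentElem_isNilpotent_sub_one_sub {S : Type*} [CommRing S] {x : S}
    (h6 : IsNilpotent (6 : S)) (hx : IsNilpotent (1 - x ^ 2)) :
    ∃ e : S, IsIdempotentElem e ∧ IsNilpotent (x - 1 - e) := by
  apply exists_isIdempotentElem_isNilpotent_sub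
  have h3 : 3 * (x - 1) ∈ nilradical S := by
    refine (mem_nilradical.2 (IsNilpotent.of_pow (m := 2) ?_))
    rw [show (3 * (x - 1)) ^ 2 = -9 * (1 - x ^ 2) + 3 * (1 - x) * 6 by ring]
    exact add_mem (Ideal.mul_mem_left (nilradical S) _ hx)
      (Ideal.mul_mem_left (nilradical S) _ h6)
  rw [show (x - 1) ^ 2 - (x - 1) = -((1 - x ^ 2) + 3 * (x - 1)) by ring]
  exact neg_mem (add_mem (S := Ideal S) (s := nilradical S) hx h3)

open scoped IsMulCommutative in
/-- Three pairwise commuting elements of a ring lie in the image of a commutative ring. -/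
theorem exists_commRing_of_commute.{u} {R : Type u} [Ring R] {a b c : R}
    (hab : Commute a b) (hac : Commute a c) (hbc : Commute b c) :
    ∃ (S : Type u) (_ : CommRing S) (φ : S →+* R), Function.Injective φ ∧
      ∃ a' b' c' : S, φ a' = a ∧ φ b' = b ∧ φ c' = c := by
  let s : Set R := {a, b, c}
  have hs : ∀ x ∈ s, ∀ y ∈ s, x * y = y * x := by
    rintro x (rfl | rfl | rfl) y (rfl | rfl | rfl)
    exacts [rfl, hab, hac, hab.symm, rfl, hbc, hac.symm, hbc.symm, rfl]
  have := Algebra.isMulCommutative_adjoin ℤ hs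
  have hmem {x : R} (hx : x ∈ s) : x ∈ Algebra.adjoin ℤ s := Algebra.subset_adjoin hx
  exact ⟨Algebra.adjoin ℤ s, inferInstance, (Algebra.adjoin ℤ s).val.toRingHom,
    Subtype.val_injective, ⟨a, hmem (by simp [s])⟩, ⟨b, hmem (by simp [s])⟩,
    ⟨c, hmem (by simp [s])⟩, rfl, rfl, rfl⟩

/-- `R` is a strong UNII-ring iff `1 - u²` is nilpotent for every unit `u` and
`6` is nilpotent in `R`. -/
theorem stmt_17 (R : Type*) [Ring R] :
    IsStrongUNIIRing R ↔
      (∀ u : Rˣ, IsNilpotent (1 - (u : R) ^ 2)) ∧ IsNilpotent (6 : R) := by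
  constructor
  · intro h
    have key (u : Rˣ) : ∃ (S : Type _) (_ : CommRing S) (φ : S →+* R), Function.Injective φ ∧
        ∃ x : S, φ x = u ∧ IsNilpotent (x * (x - 1) * (x - 2)) := by
      obtain ⟨b, e, f, hb, he, hf, hbe, hbf, hef, hu⟩ := h u
      obtain ⟨S, _, φ, hφ, b, e, f, rfl, rfl, rfl⟩ := exists_commRing_of_commute hbe hbf hef
      refine ⟨S, _, φ, hφ, b + e + f, by simp [hu], ?_⟩
      exact isNilpotent_mul_of_eq_add_idempotents ((IsNilpotent.map_iff hφ).1 hb)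
        (hφ (by simpa using he.eq)) (hφ (by simpa using hf.eq))
    have h6 : IsNilpotent (6 : R) := by
      obtain ⟨S, _, φ, hφ, x, hx, hn⟩ := key (-1)
      obtain rfl : x = -1 := hφ (by simpa using hx)
      have := hn.neg.map φ
      rwa [show -((-1 : S) * (-1 - 1) * (-1 - 2)) = 6 by norm_num, map_ofNat] at this
    refine ⟨fun u ↦ ?_, h6⟩
    obtain ⟨S, _, φ, hφ, x, hx, hn⟩ := key u
    have h6' : IsNilpotent (6 : S) := (IsNilpotent.map_iff hφ).1 (by simpa [map_ofNat] using h6)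
    have hu := (isNilpotent_mul_one_sub_sq h6' hn).map φ
    rw [map_mul, map_sub, map_one, map_pow, hx] at hu
    refine (u.isUnit.isNilpotent_unit_mul_of_commute_iff ?_).1 hu
    exact (Commute.one_left _).sub_left ((Commute.refl (u : R)).pow_left 2)
  · rintro ⟨h, h6⟩ u
    obtain ⟨S, _, φ, hφ, x, -, -, hx, -⟩ :=
      exists_commRing_of_commute (Commute.refl (u : R)) (Commute.refl _) (Commute.refl _)
    obtain ⟨e, he, hn⟩ := exists_isIdempotentElem_isNilpotent_sub_one_sub (x := x)
      ((IsNilpotent.map_iff hφ).1 (by simpa [map_ofNat] using h6))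
      ((IsNilpotent.map_iff hφ).1 (by simpa [hx] using h u))
    refine ⟨φ (x - 1 - e), 1, φ e, hn.map φ, .one, he.map φ, .one_right _,
      (Commute.all _ _).map φ, .one_left _, ?_⟩
    rw [← hx, map_sub, map_sub, map_one]
    abel
end
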